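/- For every s ∈ [0, 0.041], the sum over all primes p of ( −log(1 − p^(s−1)) − p^(s−1) ) converges and is at most 0.35. -/

import Mathlib

open Finset

/-- An upper bound for `100000 * n ^ 0.041` when `n ≤ 400`. -/
def rpowBoundNum (n : ℕ) : ℕ :=
  if n ≤ 2 then 102883 else if n ≤ 3 then 104608 else if n ≤ 5 then 106822 else
  if n ≤ 7 then 108306 else if n ≤ 11 then 110331 else if n ≤ 13 then 111090 else
  if n ≤ 19 then 112832 else if n ≤ 31 then 115119 else if n ≤ 47 then 117100 else
  if n ≤ 71 then 119098 else if n ≤ 113 then 121389 else if n ≤ 200 then 124264 else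
  if n ≤ 300 then 126347 else 127846

theorem rpowBoundNum_spec :
    ∀ n < 401, n ^ 41 * 100000 ^ 1000 ≤ rpowBoundNum n ^ 1000 ∧ rpowBoundNum n < 200000 := by
  decide +kernel

/-- A rational upper bound for `n ^ 0.041` when `n ≤ 400`. -/
def rpowBound (n : ℕ) : ℚ :=
  rpowBoundNum n / 100000

/-- A rational upper bound for `-log (1 - x) - x`, from the Taylor polynomial of degree `16`. -/
def logCorrectionBound (x : ℚ) : ℚ :=
  ∑ i ∈ range 16, x ^ (i + 1) / (i + 1) - x + x ^ 17 / (1 - x)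

/-- The numbers in `[2, 400]` without a proper prime divisor below `20`, that is, the primes,
selected by a test that the kernel evaluates quickly. -/
def sievedRange : Finset ℕ :=
  {n ∈ range 401 | 2 ≤ n ∧ ∀ q ∈ ([2, 3, 5, 7, 11, 13, 17, 19] : List ℕ), n % q = 0 → n = q}

theorem filter_prime_subset_sievedRange : {n ∈ range 401 | n.Prime} ⊆ sievedRange := by
  intro n hn
  rw [mem_filter] at hn
  refine mem_filter.2 ⟨hn.1, hn.2.two_le, fun q hq hdvd => ?_⟩
  have hq1 : q ≠ 1 := by rintro rfl; simp at hq
  exact ((hn.2.eq_one_or_self_of_dvd q (Nat.dvd_of_mod_eq_zero hdvd)).resolve_left hq1).symm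

theorem sum_logCorrectionBound_le :
    ∑ n ∈ sievedRange, logCorrectionBound (rpowBound n / n) ≤ 3487 / 10000 := by
  decide +kernel

theorem rpowBound_div_lt_one {n : ℕ} (h2 : 2 ≤ n) (hn : n ≤ 400) : rpowBound n / n < 1 := by
  have h : (2 : ℚ) ≤ n := by exact_mod_cast h2
  have hb : (rpowBoundNum n : ℚ) < 200000 := by
    exact_mod_cast (rpowBoundNum_spec n (by omega)).2
  rw [div_lt_one (by linarith), rpowBound, div_lt_iff₀ (by norm_num)]
  linarith

/-- The comparison `x ^ 41 ≤ c ^ 1000` bounds `x ^ 0.041`. -/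
theorem rpow_le_of_pow_le {x c : ℝ} (hx : 0 ≤ x) (hc : 0 ≤ c) (h : x ^ 41 ≤ c ^ 1000) :
    x ^ (0.041 : ℝ) ≤ c := by
  refine le_of_pow_le_pow_left₀ (n := 1000) (by norm_num) hc ?_
  rw [← Real.rpow_natCast, ← Real.rpow_mul hx]
  have : (0.041 : ℝ) * (1000 : ℕ) = (41 : ℕ) := by norm_num
  rwa [this, Real.rpow_natCast]

theorem rpow_le_rpowBound {n : ℕ} (hn : n ≤ 400) : (n : ℝ) ^ (0.041 : ℝ) ≤ (rpowBound n : ℝ) := by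
  have hc : ((rpowBound n : ℚ) : ℝ) = (rpowBoundNum n : ℝ) / 100000 := by
    simp [rpowBound]
  rw [hc]
  refine rpow_le_of_pow_le (by positivity) (by positivity) ?_
  rw [div_pow, le_div_iff₀ (by positivity)]
  exact_mod_cast (rpowBoundNum_spec n (by omega)).1

theorem neg_log_one_sub_sub_mono {x y : ℝ} (hx : 0 ≤ x) (hxy : x ≤ y) (hy : y < 1) :
    -Real.log (1 - x) - x ≤ -Real.log (1 - y) - y := by
  have hx1 : 0 < 1 - x := by linarith
  have h := Real.log_le_sub_one_of_pos (div_pos (sub_pos.2 hy) hx1)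
  rw [Real.log_div (by linarith) hx1.ne'] at h
  have h' : (1 - y) / (1 - x) - 1 ≤ x - y := by
    rw [div_sub_one hx1.ne', div_le_iff₀ hx1]
    nlinarith
  linarith

theorem neg_log_one_sub_sub_nonneg {x : ℝ} (hx1 : x < 1) : 0 ≤ -Real.log (1 - x) - x := by
  have := Real.log_le_sub_one_of_pos (sub_pos.2 hx1)
  linarith

theorem neg_log_one_sub_le {x : ℝ} (hx : 0 ≤ x) (hx1 : x < 1) (k : ℕ) :
    -Real.log (1 - x) ≤ ∑ i ∈ range k, x ^ (i + 1) / (i + 1) + x ^ (k + 1) / (1 - x) := by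
  have h := Real.abs_log_sub_add_sum_range_le (by rwa [abs_of_nonneg hx]) k
  rw [abs_of_nonneg hx] at h
  linarith [(abs_le.1 h).1]

theorem term_nonneg {n : ℕ} (hn : 2 ≤ n) {s : ℝ} (hs : s ≤ 0.041) :
    0 ≤ -Real.log (1 - (n : ℝ) ^ (s - 1)) - (n : ℝ) ^ (s - 1) :=
  neg_log_one_sub_sub_nonneg
    (Real.rpow_lt_one_of_one_lt_of_neg (by exact_mod_cast hn) (by linarith))

theorem rpow_sub_one_le {n : ℕ} (hn : 1 ≤ n) {s : ℝ} (hs : s ≤ 0.041) :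
    (n : ℝ) ^ (s - 1) ≤ (n : ℝ) ^ (0.041 : ℝ) / n := by
  have hn' : (1 : ℝ) ≤ n := by exact_mod_cast hn
  rw [← Real.rpow_sub_one (by linarith)]
  exact Real.rpow_le_rpow_of_exponent_le hn' (by linarith)

theorem term_le_logCorrectionBound {n : ℕ} (h2 : 2 ≤ n) (hn : n ≤ 400) {s : ℝ} (hs : s ≤ 0.041) :
    -Real.log (1 - (n : ℝ) ^ (s - 1)) - (n : ℝ) ^ (s - 1) ≤
      (logCorrectionBound (rpowBound n / n) : ℝ) := by
  have hle : (n : ℝ) ^ (s - 1) ≤ ((rpowBound n / n : ℚ) : ℝ) := by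
    refine (rpow_sub_one_le (by omega) hs).trans ?_
    push_cast
    gcongr
    exact rpow_le_rpowBound hn
  have hlt : ((rpowBound n / n : ℚ) : ℝ) < 1 := by exact_mod_cast rpowBound_div_lt_one h2 hn
  have h0 : 0 ≤ (n : ℝ) ^ (s - 1) := by positivity
  have hlog := neg_log_one_sub_le (h0.trans hle) hlt 16
  refine (neg_log_one_sub_sub_mono h0 hle hlt).trans ?_
  generalize rpowBound n / n = q at hlog ⊢
  unfold logCorrectionBound
  push_cast
  linarith

/-- The telescoping estimate behind the bound for the tail of the sum. -/
theorem two_mul_rpow_le_sub {x : ℝ} (hx : 2 < x) :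
    2 * 0.918 * x ^ (-1.918 : ℝ) ≤ (x - 2) ^ (-0.918 : ℝ) - x ^ (-0.918 : ℝ) := by
  have hx0 : 0 < x := by linarith
  have hr : 0 < (x - 2) / x := div_pos (by linarith) hx0
  have hbern : 1 + 0.918 * (2 / x) ≤ ((x - 2) / x) ^ (-0.918 : ℝ) := by
    rw [Real.rpow_def_of_pos hr]
    have h₁ := Real.add_one_le_exp (Real.log ((x - 2) / x) * -0.918)
    have h₂ := Real.log_le_sub_one_of_pos hr
    have h₃ : (x - 2) / x - 1 = -(2 / x) := by field_simp; ring
    linarith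
  have hsplit : (x - 2) ^ (-0.918 : ℝ) = ((x - 2) / x) ^ (-0.918 : ℝ) * x ^ (-0.918 : ℝ) := by
    rw [← Real.mul_rpow hr.le hx0.le, div_mul_cancel₀ _ hx0.ne']
  have hexp : x ^ (-1.918 : ℝ) = x ^ (-0.918 : ℝ) / x := by
    rw [← Real.rpow_sub_one hx0.ne']
    norm_num
  have hmul := mul_le_mul_of_nonneg_right hbern (Real.rpow_nonneg hx0.le (-0.918))
  rw [hsplit, hexp]
  calc 2 * 0.918 * (x ^ (-0.918 : ℝ) / x)
      = (1 + 0.918 * (2 / x)) * x ^ (-0.918 : ℝ) - x ^ (-0.918 : ℝ) := by ring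
    _ ≤ _ := by linarith

theorem term_le_rpow {n : ℕ} (hn : 400 ≤ n) {s : ℝ} (hs : s ≤ 0.041) :
    -Real.log (1 - (n : ℝ) ^ (s - 1)) - (n : ℝ) ^ (s - 1) ≤ 0.504 * (n : ℝ) ^ (-1.918 : ℝ) := by
  have hn' : (400 : ℝ) ≤ n := by exact_mod_cast hn
  have hn0 : (0 : ℝ) < n := by linarith
  have hsmall : (n : ℝ) ^ (-0.959 : ℝ) ≤ 0.0033 := by
    calc (n : ℝ) ^ (-0.959 : ℝ) ≤ (400 : ℝ) ^ (-0.959 : ℝ) :=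
          Real.rpow_le_rpow_of_nonpos (by norm_num) hn' (by norm_num)
      _ = (400 : ℝ) ^ (0.041 : ℝ) / 400 := by
          rw [← Real.rpow_sub_one (by norm_num)]
          norm_num
      _ ≤ 1.3 / 400 := by
          gcongr
          refine (rpow_le_rpowBound le_rfl).trans ?_
          norm_num [rpowBound, rpowBoundNum]
      _ ≤ 0.0033 := by norm_num
  have hsq : (n : ℝ) ^ (-1.918 : ℝ) = ((n : ℝ) ^ (-0.959 : ℝ)) ^ 2 := by
    rw [← Real.rpow_natCast, ← Real.rpow_mul hn0.le]
    norm_num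
  have hle : (n : ℝ) ^ (s - 1) ≤ (n : ℝ) ^ (-0.959 : ℝ) :=
    Real.rpow_le_rpow_of_exponent_le (by linarith) (by linarith)
  have h0 : 0 ≤ (n : ℝ) ^ (s - 1) := by positivity
  rw [hsq]
  refine (neg_log_one_sub_sub_mono h0 hle (by linarith)).trans ?_
  have hx0 := h0.trans hle
  generalize (n : ℝ) ^ (-0.959 : ℝ) = x at hsmall hx0 ⊢
  have hlog := neg_log_one_sub_le hx0 (by linarith) 2
  have hrem : x ^ (2 + 1) / (1 - x) ≤ 0.004 * x ^ 2 := by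
    rw [div_le_iff₀ (by linarith)]
    nlinarith [mul_nonneg (sq_nonneg x) (sub_nonneg.2 hsmall)]
  norm_num [sum_range_succ] at hlog hrem ⊢
  linarith

/-- The partial sums of the series over odd ranges, with the telescoping majorant of the tail. -/
theorem sum_range_add_tail_le {s : ℝ} (hs : s ≤ 0.041) (m : ℕ) :
    ∑ n ∈ range (2 * m + 401) with n.Prime,
        (-Real.log (1 - (n : ℝ) ^ (s - 1)) - (n : ℝ) ^ (s - 1)) +
      0.504 / (2 * 0.918) * (2 * m + 399 : ℝ) ^ (-0.918 : ℝ) ≤ 0.35 := by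
  induction m with
  | zero =>
    have hfin : ∑ n ∈ range 401 with n.Prime,
        (-Real.log (1 - (n : ℝ) ^ (s - 1)) - (n : ℝ) ^ (s - 1)) ≤ 0.3487 := by
      have hmem {n : ℕ} (hn : n ∈ sievedRange) : 2 ≤ n ∧ n ≤ 400 := by
        rw [sievedRange, mem_filter, mem_range] at hn
        omega
      calc _ ≤ ∑ n ∈ sievedRange, (-Real.log (1 - (n : ℝ) ^ (s - 1)) - (n : ℝ) ^ (s - 1)) :=
            sum_le_sum_of_subset_of_nonneg filter_prime_subset_sievedRange
              fun n hn _ => term_nonneg (hmem hn).1 hs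
        _ ≤ ∑ n ∈ sievedRange, (logCorrectionBound (rpowBound n / n) : ℝ) :=
            sum_le_sum fun n hn => term_le_logCorrectionBound (hmem hn).1 (hmem hn).2 hs
        _ ≤ ((3487 / 10000 : ℚ) : ℝ) := by
            rw [← Rat.cast_sum, Rat.cast_le]
            exact sum_logCorrectionBound_le
        _ = 0.3487 := by norm_num
    have hpow : (399 : ℝ) ^ (-0.918 : ℝ) ≤ 0.0043 := by
      have h : (399 : ℝ) ^ (0.041 : ℝ) ≤ 1.3 := by
        refine (rpow_le_rpowBound (n := 399) (by norm_num)).trans ?_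
        norm_num [rpowBound, rpowBoundNum]
      have h' : (399 : ℝ) ^ (-0.918 : ℝ) = ((399 : ℝ) ^ (0.041 : ℝ)) ^ 2 / 399 := by
        rw [← Real.rpow_natCast, ← Real.rpow_mul (by norm_num), ← Real.rpow_sub_one (by norm_num)]
        norm_num
      rw [h', div_le_iff₀ (by norm_num)]
      calc _ ≤ (1.3 : ℝ) ^ 2 := by gcongr
        _ ≤ _ := by norm_num
    norm_num at hfin hpow ⊢
    linarith
  | succ m ih =>
    have heven : ¬ (2 * m + 402).Prime := fun h => by
      have := h.eq_one_or_self_of_dvd 2 (by omega)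
      omega
    have hm : (0 : ℝ) ≤ m := by positivity
    have htel := two_mul_rpow_le_sub (x := 2 * m + 401) (by linarith)
    rw [show (2 * m + 401 - 2 : ℝ) = 2 * m + 399 by ring] at htel
    have hterm : (if (2 * m + 401).Prime then
        -Real.log (1 - ((2 * m + 401 : ℕ) : ℝ) ^ (s - 1)) - ((2 * m + 401 : ℕ) : ℝ) ^ (s - 1)
        else 0) ≤ 0.504 * (2 * m + 401 : ℝ) ^ (-1.918 : ℝ) := by
      split_ifs
      · simpa using term_le_rpow (n := 2 * m + 401) (by omega) hs
      · positivity
    rw [sum_filter] at ih ⊢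
    rw [show 2 * (m + 1) + 401 = 2 * m + 401 + 1 + 1 by ring, sum_range_succ, sum_range_succ,
      if_neg (show ¬ (2 * m + 401 + 1).Prime from heven), add_zero,
      show (2 * (m + 1 : ℕ) + 399 : ℝ) = 2 * m + 401 by push_cast; ring]
    linarith

/-- For every `s ∈ [0, 0.041]`, the sum over all primes `p` of
`−log(1 − p^(s−1)) − p^(s−1)` converges and is at most `0.35`. -/
theorem prime_log_correction_sum_le (s : ℝ) (hs0 : 0 ≤ s) (hs : s ≤ 0.041) :
    Summable (fun p : {p : ℕ // p.Prime} =>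
      -Real.log (1 - ((p : ℕ) : ℝ) ^ (s - 1)) - ((p : ℕ) : ℝ) ^ (s - 1)) ∧
    (∑' p : {p : ℕ // p.Prime},
      (-Real.log (1 - ((p : ℕ) : ℝ) ^ (s - 1)) - ((p : ℕ) : ℝ) ^ (s - 1))) ≤
      0.35 := by
  let f : ℕ → ℝ := fun n => -Real.log (1 - (n : ℝ) ^ (s - 1)) - (n : ℝ) ^ (s - 1)
  have hnonneg (n : ℕ) : 0 ≤ {p : ℕ | p.Prime}.indicator f n :=
    Set.indicator_nonneg (fun p (hp : p.Prime) => term_nonneg hp.two_le hs) n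
  have hsum (n : ℕ) : ∑ i ∈ range n, {p : ℕ | p.Prime}.indicator f i ≤ 0.35 := by
    calc ∑ i ∈ range n, {p : ℕ | p.Prime}.indicator f i
        ≤ ∑ i ∈ range (2 * n + 401), {p : ℕ | p.Prime}.indicator f i :=
          sum_le_sum_of_subset_of_nonneg (range_mono (by omega)) fun i _ _ => hnonneg i
      _ = ∑ i ∈ range (2 * n + 401) with i.Prime, f i := by
          rw [sum_filter]
          exact sum_congr rfl fun i _ => by simp [Set.indicator_apply]
      _ ≤ 0.35 := by
          have h := sum_range_add_tail_le hs n
          have : 0 ≤ 0.504 / (2 * 0.918) * (2 * n + 399 : ℝ) ^ (-0.918 : ℝ) := by positivity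
          linarith
  constructor
  · exact (summable_subtype_iff_indicator (f := f) (s := {p | p.Prime})).2
      (summable_of_sum_range_le hnonneg hsum)
  · exact (tsum_subtype {p : ℕ | p.Prime} f).trans_le
      (Real.tsum_le_of_sum_range_le hnonneg hsum)
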